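/- Let Λ = {A,B}. Let ρ = (L ←φ_L– I –φ_R→ R) be the rule where L has nodes {1,2} and a single A-labeled edge from 1 to 2, I has nodes {1,2} and no edges, R has nodes {1,2} and a single B-labeled edge from 1 to 2, and φ_L, φ_R are the identity on nodes. Let T be the graph with nodes {1,2} and three edges: an A-labeled edge from 1 to 2, an A-labeled loop at 2, and a B-labeled loop at 2. Then: (a) L(T) is the class of all {A,B}-labeled graphs, hence L(T) is closed under rewriting via ρ; and (b) there exists a morphism t_L : L → T (mapping the A-edge of L to the A-edge from 1 to 2 of T) such that no morphism t_R : R → T satisfies t_L ∘ φ_L = t_R ∘ φ_R. Hence the characterization of closure under DPO rewriting via morphisms into the core cannot be weakened to morphisms into T itself. -/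

import Mathlib

/-- A `Λ`-labeled graph: finite sets of nodes and edges, with source/target maps
and an edge labeling. -/
structure LGraph (Λ : Type) : Type 1 where
  V : Type
  E : Type
  finV : Finite V
  finE : Finite E
  src : E → V
  tgt : E → V
  lab : E → Λ

/-- A morphism of `Λ`-labeled graphs: maps on nodes and edges commuting with
source and target and preserving labels. -/
structure LGraph.Hom {Λ : Type} (G H : LGraph Λ) : Type where
  fV : G.V → H.V
  fE : G.E → H.E
  src_comm : ∀ e, H.src (fE e) = fV (G.src e)
  tgt_comm : ∀ e, H.tgt (fE e) = fV (G.tgt e)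
  lab_comm : ∀ e, H.lab (fE e) = G.lab e

/-- Composition of graph morphisms. -/
def LGraph.Hom.comp {Λ : Type} {G H K : LGraph Λ} (ψ : LGraph.Hom H K)
    (φ : LGraph.Hom G H) : LGraph.Hom G K where
  fV := ψ.fV ∘ φ.fV
  fE := ψ.fE ∘ φ.fE
  src_comm e := by simp [Function.comp_apply, ψ.src_comm, φ.src_comm]
  tgt_comm e := by simp [Function.comp_apply, ψ.tgt_comm, φ.tgt_comm]
  lab_comm e := by simp [Function.comp_apply, ψ.lab_comm, φ.lab_comm]

/-- `G → H`: there exists some graph morphism from `G` to `H`. -/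
def LGraph.Arrow {Λ : Type} (G H : LGraph Λ) : Prop := Nonempty (LGraph.Hom G H)

/-- The type graph language `L(T) = {G | G → T}`. -/
def TGLang {Λ : Type} (T : LGraph Λ) : Set (LGraph Λ) := {G | LGraph.Arrow G T}

/-- The restriction graph language `L_R(R) = {G | R ↛ G}`. -/
def RGLang {Λ : Type} (R : LGraph Λ) : Set (LGraph Λ) := {G | ¬ LGraph.Arrow R G}

/-- `(f, g, h, k)` is a pushout square: `h ∘ f = k ∘ g` and the universal property. -/
structure IsPushout {Λ : Type} {A B C D : LGraph Λ}
    (f : LGraph.Hom A B) (g : LGraph.Hom A C)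
    (h : LGraph.Hom B D) (k : LGraph.Hom C D) : Prop where
  comm : h.comp f = k.comp g
  universal : ∀ (X : LGraph Λ) (h' : LGraph.Hom B X) (k' : LGraph.Hom C X),
      h'.comp f = k'.comp g → ∃! u : LGraph.Hom D X, u.comp h = h' ∧ u.comp k = k'

/-- `G ⇒_ρ H` for the DPO rule `ρ = (L ←φL– I –φR→ R)`: there are a graph `C` and
morphisms forming the two pushout squares of a DPO diagram. -/
def Rewrites {Λ : Type} {L I R : LGraph Λ}
    (φL : LGraph.Hom I L) (φR : LGraph.Hom I R) (G H : LGraph Λ) : Prop :=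
  ∃ (C : LGraph Λ) (m : LGraph.Hom L G) (n : LGraph.Hom I C)
    (m' : LGraph.Hom R H) (c1 : LGraph.Hom C G) (c2 : LGraph.Hom C H),
    IsPushout φL n m c1 ∧ IsPushout φR n m' c2

/-- The two-element label set `Λ = {A, B}`. -/
inductive Lab : Type
  | A
  | B
deriving DecidableEq

/-- The left-hand side `L`: nodes `1,2` and a single `A`-labeled edge `1 → 2`. -/
def Lgr : LGraph Lab where
  V := Fin 2
  E := Unit
  finV := inferInstance
  finE := inferInstance
  src _ := 0
  tgt _ := 1
  lab _ := Lab.A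

/-- The interface `I`: nodes `1,2` and no edges. -/
def Igr : LGraph Lab where
  V := Fin 2
  E := Empty
  finV := inferInstance
  finE := inferInstance
  src e := e.elim
  tgt e := e.elim
  lab e := e.elim

/-- The right-hand side `R`: nodes `1,2` and a single `B`-labeled edge `1 → 2`. -/
def Rgr : LGraph Lab where
  V := Fin 2
  E := Unit
  finV := inferInstance
  finE := inferInstance
  src _ := 0
  tgt _ := 1
  lab _ := Lab.B

/-- `φ_L : I → L`, the identity on nodes. -/
def ruleL : LGraph.Hom Igr Lgr where
  fV := id
  fE e := e.elim
  src_comm e := e.elim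
  tgt_comm e := e.elim
  lab_comm e := e.elim

/-- `φ_R : I → R`, the identity on nodes. -/
def ruleR : LGraph.Hom Igr Rgr where
  fV := id
  fE e := e.elim
  src_comm e := e.elim
  tgt_comm e := e.elim
  lab_comm e := e.elim

/-- The type graph `T`: nodes `1,2`, an `A`-edge `1 → 2` (edge `0`), an `A`-loop at
node 2 (edge `1`) and a `B`-loop at node 2 (edge `2`). -/
def Tgr : LGraph Lab where
  V := Fin 2
  E := Fin 3
  finV := inferInstance
  finE := inferInstance
  src := ![0, 1, 1]
  tgt := ![1, 1, 1]
  lab := ![Lab.A, Lab.A, Lab.B]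

theorem mem_TGLang_Tgr (G : LGraph Lab) : G ∈ TGLang Tgr := by
  refine ⟨⟨fun _ => (1 : Fin 2),
    fun e => (match G.lab e with | Lab.A => (1 : Fin 3) | Lab.B => (2 : Fin 3)), ?_, ?_, ?_⟩⟩
  all_goals
    intro e
    cases h : G.lab e <;> rfl

/-- (a) `L(T)` is the class of all `{A,B}`-labeled graphs, hence closed under
rewriting via `ρ`; (b) nevertheless, there is a morphism `t_L : L → T` — mapping the
`A`-edge of `L` to the `A`-edge from 1 to 2 of `T` — that admits no `t_R : R → T`
with `t_L ∘ φ_L = t_R ∘ φ_R`. So the core condition cannot be weakened to `T`. -/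
theorem core_condition_cannot_be_weakened :
    TGLang Tgr = Set.univ ∧
    (∀ G H : LGraph Lab, G ∈ TGLang Tgr → Rewrites ruleL ruleR G H → H ∈ TGLang Tgr) ∧
    (∃ tL : LGraph.Hom Lgr Tgr, tL.fE () = (0 : Fin 3) ∧
      ¬ ∃ tR : LGraph.Hom Rgr Tgr, tL.comp ruleL = tR.comp ruleR) := by
  refine ⟨Set.eq_univ_of_forall mem_TGLang_Tgr, fun _ H _ _ => mem_TGLang_Tgr H, ?_⟩
  refine ⟨⟨fun v => v, fun _ => (0 : Fin 3), fun _ => rfl, fun _ => rfl, fun _ => rfl⟩, rfl, ?_⟩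
  rintro ⟨tR, h⟩
  have h0 : (0 : Fin 2) = tR.fV (0 : Fin 2) :=
    congrFun (congrArg LGraph.Hom.fV h) (0 : Fin 2)
  have hs : (![0, 1, 1] : Fin 3 → Fin 2) (tR.fE ()) = 0 := (tR.src_comm ()).trans h0.symm
  have hl : (![Lab.A, Lab.A, Lab.B] : Fin 3 → Lab) (tR.fE ()) = Lab.B := tR.lab_comm ()
  have key : ∀ e : Fin 3, (![0, 1, 1] : Fin 3 → Fin 2) e = 0 →
      (![Lab.A, Lab.A, Lab.B] : Fin 3 → Lab) e = Lab.B → False := by decide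
  exact key _ hs hl
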